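/- arXiv:2202.09673 — 4 statements merged into one kernel-verified Lean document; each statement's English description precedes it below -/
import Mathlib

section
/- Let T_b, T_φ ∈ ℝ^{N×N} be positive row-stochastic matrices with stationary distributions d_b and d_φ respectively. Let M̂ ∈ ℝ^{(N+1)×N} be the matrix whose first row is the all-ones row vector and whose remaining N rows form I − T_bᵀ, and let κ_max be the maximum, over indices i ∈ {2,…,N+1} such that deleting row i of M̂ yields an invertible N×N matrix, of the condition number κ of that N×N matrix. If ‖T_b − T_φ‖_∞ ≤ ε and ε < 1/κ_max, then ‖d_φ − d_b‖₁ ≤ ε·κ_max / (1 − ε·κ_max); in particular ‖d_φ − d_b‖₁ → 0 as ε → 0. -/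
open Matrix BigOperators

/-- The ℓ¹ norm of a vector: sum of the absolute values of its entries. -/
noncomputable def l1Norm {N : ℕ} (v : Fin N → ℝ) : ℝ := ∑ i, |v i|

/-- The operator norm induced by the ℓ¹ vector norm: maximum absolute column sum. -/
noncomputable def opNorm {N : ℕ} (M : Matrix (Fin N) (Fin N) ℝ) : ℝ :=
  ⨆ j, ∑ i, |M i j|

/-- The `‖·‖_∞` matrix norm: maximum absolute row sum. -/
noncomputable def rowNorm {N : ℕ} (M : Matrix (Fin N) (Fin N) ℝ) : ℝ :=
  ⨆ i, ∑ j, |M i j|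

/-- The condition number `κ(M) = ‖M‖₁·‖M⁻¹‖₁` with respect to the ℓ¹-induced operator norm. -/
noncomputable def condNum {N : ℕ} (M : Matrix (Fin N) (Fin N) ℝ) : ℝ :=
  opNorm M * opNorm M⁻¹

/-- The `(N+1) × N` matrix whose first row is the all-ones row vector and whose
remaining `N` rows form `I − Tᵀ`. -/
def hatMat {N : ℕ} (T : Matrix (Fin N) (Fin N) ℝ) : Matrix (Fin (N + 1)) (Fin N) ℝ :=
  Matrix.of (Fin.cons (fun _ => (1 : ℝ))
    (fun i j => ((1 : Matrix (Fin N) (Fin N) ℝ) - Tᵀ) i j))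

/-- Delete row `i` from an `(N+1) × N` matrix, yielding an `N × N` matrix. -/
def delRow {N : ℕ} (M : Matrix (Fin (N + 1)) (Fin N) ℝ) (i : Fin (N + 1)) :
    Matrix (Fin N) (Fin N) ℝ :=
  M.submatrix i.succAbove id

/-- `κ_max` for a row-stochastic matrix `T`: the maximum, over indices `i ∈ {2,…,N+1}`
(i.e. `i ≠ 0` in `Fin (N+1)`) such that deleting row `i` of `hatMat T` yields an invertible
`N×N` matrix, of the condition number of that matrix. -/
noncomputable def kappaMax {N : ℕ} (T : Matrix (Fin N) (Fin N) ℝ) : ℝ :=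
  sSup {c : ℝ | ∃ i : Fin (N + 1), i ≠ 0 ∧ IsUnit (delRow (hatMat T) i).det ∧
    c = condNum (delRow (hatMat T) i)}

lemma sum_abs_col_le_opNorm {N : ℕ} (M : Matrix (Fin N) (Fin N) ℝ) (j : Fin N) :
    ∑ i, |M i j| ≤ opNorm M :=
  le_ciSup (f := fun j => ∑ i, |M i j|) (Set.finite_range _).bddAbove j

lemma sum_abs_row_le_rowNorm {N : ℕ} (M : Matrix (Fin N) (Fin N) ℝ) (i : Fin N) :
    ∑ j, |M i j| ≤ rowNorm M :=
  le_ciSup (f := fun i => ∑ j, |M i j|) (Set.finite_range _).bddAbove i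

lemma opNorm_nonneg {N : ℕ} (M : Matrix (Fin N) (Fin N) ℝ) : 0 ≤ opNorm M :=
  Real.iSup_nonneg fun _ => Finset.sum_nonneg fun _ _ => abs_nonneg _

lemma rowNorm_nonneg {N : ℕ} (M : Matrix (Fin N) (Fin N) ℝ) : 0 ≤ rowNorm M :=
  Real.iSup_nonneg fun _ => Finset.sum_nonneg fun _ _ => abs_nonneg _

lemma l1Norm_mulVec_le {N : ℕ} (M : Matrix (Fin N) (Fin N) ℝ) (v : Fin N → ℝ) :
    l1Norm (M *ᵥ v) ≤ opNorm M * l1Norm v := by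
  unfold l1Norm
  calc ∑ i, |(M *ᵥ v) i| ≤ ∑ i, ∑ j, |M i j| * |v j| := by
        refine Finset.sum_le_sum fun i _ => ?_
        simp only [Matrix.mulVec, dotProduct, ← abs_mul]
        exact Finset.abs_sum_le_sum_abs _ _
    _ = ∑ j, (∑ i, |M i j|) * |v j| := by
        rw [Finset.sum_comm]
        simp only [Finset.sum_mul]
    _ ≤ ∑ j, opNorm M * |v j| := by
        gcongr with j
        exact sum_abs_col_le_opNorm M j
    _ = opNorm M * ∑ j, |v j| := by rw [Finset.mul_sum]

lemma l1Norm_vecMul_le {N : ℕ} (M : Matrix (Fin N) (Fin N) ℝ) (v : Fin N → ℝ) :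
    l1Norm (v ᵥ* M) ≤ rowNorm M * l1Norm v := by
  rw [← Matrix.mulVec_transpose]
  exact l1Norm_mulVec_le Mᵀ v

/-- A fixed row vector of a positive row-stochastic matrix with vanishing sum is zero. -/
lemma eq_zero_of_vecMul_eq_self_of_sum_eq_zero {N : ℕ} {T : Matrix (Fin N) (Fin N) ℝ}
    (hpos : ∀ i j, 0 < T i j) (hrow : ∀ i, ∑ j, T i j = 1) {x : Fin N → ℝ}
    (hx : x ᵥ* T = x) (hsum : ∑ i, x i = 0) : x = 0 := by
  rcases isEmpty_or_nonempty (Fin N) with h | h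
  · exact Subsingleton.elim _ _
  obtain ⟨p, hp⟩ := Finite.exists_min (fun p : Fin N × Fin N => T p.1 p.2)
  set m := T p.1 p.2 with hm
  have hm0 : 0 < m := hpos _ _
  have hj (j : Fin N) : |x j| ≤ ∑ i, |x i| * (T i j - m) := by
    have h1 : x j = ∑ i, x i * (T i j - m) := by
      simp only [mul_sub, Finset.sum_sub_distrib, ← Finset.sum_mul, hsum, zero_mul, sub_zero]
      exact (congrFun hx j).symm
    calc |x j| = |∑ i, x i * (T i j - m)| := by rw [← h1]
      _ ≤ ∑ i, |x i * (T i j - m)| := Finset.abs_sum_le_sum_abs _ _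
      _ = _ := Finset.sum_congr rfl fun i _ => by
          rw [abs_mul, abs_of_nonneg (sub_nonneg.2 (hp (i, j)))]
  have htot : ∑ j, |x j| ≤ (∑ i, |x i|) * (1 - N * m) := by
    calc ∑ j, |x j| ≤ ∑ j, ∑ i, |x i| * (T i j - m) := Finset.sum_le_sum fun j _ => hj j
      _ = _ := by
        rw [Finset.sum_comm, Finset.sum_mul]
        simp [← Finset.mul_sum, Finset.sum_sub_distrib, hrow]
  have hN : (0 : ℝ) < N := by exact_mod_cast Fin.pos_iff_nonempty.2 h
  have h0 : ∑ j, |x j| = 0 :=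
    le_antisymm (by nlinarith [mul_pos hN hm0]) (Finset.sum_nonneg fun _ _ => abs_nonneg _)
  funext j
  simpa using (Finset.sum_eq_zero_iff_of_nonneg fun _ _ => abs_nonneg _).1 h0 j

lemma delRow_last_mulVec_zero {n : ℕ} (T : Matrix (Fin (n + 1)) (Fin (n + 1)) ℝ)
    (x : Fin (n + 1) → ℝ) :
    (delRow (hatMat T) (Fin.last (n + 1)) *ᵥ x) 0 = ∑ i, x i := by
  simp [delRow, hatMat, Matrix.mulVec, dotProduct]

lemma delRow_last_mulVec_succ {n : ℕ} (T : Matrix (Fin (n + 1)) (Fin (n + 1)) ℝ)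
    (x : Fin (n + 1) → ℝ) (k : Fin n) :
    (delRow (hatMat T) (Fin.last (n + 1)) *ᵥ x) k.succ
      = x k.castSucc - (x ᵥ* T) k.castSucc := by
  have h : (delRow (hatMat T) (Fin.last (n + 1)) *ᵥ x) k.succ
      = (((1 : Matrix (Fin (n + 1)) (Fin (n + 1)) ℝ) - Tᵀ) *ᵥ x) k.castSucc := by
    simp only [delRow, hatMat, Matrix.mulVec, dotProduct, Matrix.submatrix_apply,
      Fin.succAbove_last, ← Fin.succ_castSucc, Matrix.of_apply, Fin.cons_succ, id]
  rw [h, Matrix.sub_mulVec, Matrix.one_mulVec, Matrix.mulVec_transpose, Pi.sub_apply]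

lemma sum_vecMul_of_row_sum {N : ℕ} {T : Matrix (Fin N) (Fin N) ℝ}
    (hrow : ∀ i, ∑ j, T i j = 1) (x : Fin N → ℝ) : ∑ j, (x ᵥ* T) j = ∑ i, x i := by
  simp only [Matrix.vecMul, dotProduct]
  rw [Finset.sum_comm]
  simp [← Finset.mul_sum, hrow]

lemma isUnit_det_delRow_last {n : ℕ} {T : Matrix (Fin (n + 1)) (Fin (n + 1)) ℝ}
    (hpos : ∀ i j, 0 < T i j) (hrow : ∀ i, ∑ j, T i j = 1) :
    IsUnit (delRow (hatMat T) (Fin.last (n + 1))).det := by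
  rw [isUnit_iff_ne_zero]
  intro hdet
  obtain ⟨x, hx0, hx⟩ := Matrix.exists_mulVec_eq_zero_iff.2 hdet
  have hsum : ∑ i, x i = 0 := by
    rw [← delRow_last_mulVec_zero T, hx, Pi.zero_apply]
  have hcast (k : Fin n) : (x ᵥ* T) k.castSucc = x k.castSucc := by
    have h := delRow_last_mulVec_succ T x k
    rw [hx, Pi.zero_apply] at h
    linarith
  have hlast : (x ᵥ* T) (Fin.last n) = x (Fin.last n) := by
    have h := sum_vecMul_of_row_sum hrow x
    simpa only [Fin.sum_univ_castSucc, hcast, add_right_inj] using h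
  refine hx0 (eq_zero_of_vecMul_eq_self_of_sum_eq_zero hpos hrow (funext fun j => ?_) hsum)
  exact Fin.lastCases hlast hcast j

lemma one_le_opNorm_delRow_last {n : ℕ} (T : Matrix (Fin (n + 1)) (Fin (n + 1)) ℝ) :
    1 ≤ opNorm (delRow (hatMat T) (Fin.last (n + 1))) := by
  refine le_trans ?_ (sum_abs_col_le_opNorm _ 0)
  rw [Fin.sum_univ_succ]
  have h : |delRow (hatMat T) (Fin.last (n + 1)) 0 0| = 1 := by simp [delRow, hatMat]
  rw [h]
  exact le_add_of_nonneg_right (Finset.sum_nonneg fun _ _ => abs_nonneg _)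

lemma condNum_le_kappaMax {N : ℕ} (T : Matrix (Fin N) (Fin N) ℝ) {i : Fin (N + 1)} (hi : i ≠ 0)
    (hdet : IsUnit (delRow (hatMat T) i).det) :
    condNum (delRow (hatMat T) i) ≤ kappaMax T := by
  refine le_csSup (Set.Finite.bddAbove ?_) ⟨i, hi, hdet, rfl⟩
  refine (Set.finite_range fun i => condNum (delRow (hatMat T) i)).subset ?_
  rintro c ⟨j, -, -, rfl⟩
  exact ⟨j, rfl⟩

/-- If `T_b, T_φ` are positive row-stochastic matrices with stationary distributions
`d_b, d_φ`, `‖T_b − T_φ‖_∞ ≤ ε` and `ε < 1/κ_max`, then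
`‖d_φ − d_b‖₁ ≤ ε·κ_max / (1 − ε·κ_max)`. -/
theorem stationary_distribution_perturbation {N : ℕ}
    (Tb Tφ : Matrix (Fin N) (Fin N) ℝ)
    (hTb_pos : ∀ i j, 0 < Tb i j) (hTb_row : ∀ i, ∑ j, Tb i j = 1)
    (hTφ_pos : ∀ i j, 0 < Tφ i j) (hTφ_row : ∀ i, ∑ j, Tφ i j = 1)
    (db dφ : Fin N → ℝ)
    (hdb_nonneg : ∀ i, 0 ≤ db i) (hdb_sum : ∑ i, db i = 1)
    (hdb_stat : Matrix.vecMul db Tb = db)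
    (hdφ_nonneg : ∀ i, 0 ≤ dφ i) (hdφ_sum : ∑ i, dφ i = 1)
    (hdφ_stat : Matrix.vecMul dφ Tφ = dφ)
    (ε : ℝ) (hε : rowNorm (Tb - Tφ) ≤ ε) (hεκ : ε < 1 / kappaMax Tb) :
    l1Norm (dφ - db) ≤ ε * kappaMax Tb / (1 - ε * kappaMax Tb) := by
  obtain _ | n := N
  · simp at hdb_sum
  set A := delRow (hatMat Tb) (Fin.last (n + 1)) with hA
  have hdet : IsUnit A.det := isUnit_det_delRow_last hTb_pos hTb_row
  have hκ : opNorm A⁻¹ ≤ kappaMax Tb :=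
    (le_mul_of_one_le_left (opNorm_nonneg _) (one_le_opNorm_delRow_last Tb)).trans
      (condNum_le_kappaMax Tb (Fin.last_pos.ne') hdet)
  have hε0 : 0 ≤ ε := (rowNorm_nonneg _).trans hε
  have hκ0 : 0 < kappaMax Tb := one_div_pos.1 (hε0.trans_lt hεκ)
  have hlt : ε * kappaMax Tb < 1 := (lt_div_iff₀ hκ0).1 hεκ
  have hnorm : l1Norm dφ = 1 := by
    simp only [l1Norm, abs_of_nonneg (hdφ_nonneg _), hdφ_sum]
  have hres : l1Norm (A *ᵥ (dφ - db)) ≤ ε := by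
    have hdiff : (dφ - db) - (dφ - db) ᵥ* Tb = -(dφ ᵥ* (Tb - Tφ)) := by
      rw [Matrix.sub_vecMul, Matrix.vecMul_sub, hdb_stat, hdφ_stat]
      abel
    have hle : l1Norm (A *ᵥ (dφ - db)) ≤ l1Norm (dφ ᵥ* (Tb - Tφ)) := by
      unfold l1Norm
      rw [Fin.sum_univ_succ, Fin.sum_univ_castSucc, hA, delRow_last_mulVec_zero]
      have hk (k : Fin n) : |(delRow (hatMat Tb) (Fin.last (n + 1)) *ᵥ (dφ - db)) k.succ|
          = |(dφ ᵥ* (Tb - Tφ)) k.castSucc| := by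
        rw [delRow_last_mulVec_succ, ← Pi.sub_apply, hdiff, Pi.neg_apply, abs_neg]
      simp only [hk, Pi.sub_apply, Finset.sum_sub_distrib, hdφ_sum, hdb_sum, sub_self, abs_zero,
        zero_add]
      exact le_add_of_nonneg_right (abs_nonneg _)
    have h := l1Norm_vecMul_le (Tb - Tφ) dφ
    rw [hnorm, mul_one] at h
    exact hle.trans (h.trans hε)
  have hbound : l1Norm (dφ - db) ≤ ε * kappaMax Tb := by
    calc l1Norm (dφ - db) = l1Norm (A⁻¹ *ᵥ (A *ᵥ (dφ - db))) := by
          rw [Matrix.mulVec_mulVec, Matrix.nonsing_inv_mul _ hdet, Matrix.one_mulVec]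
      _ ≤ opNorm A⁻¹ * l1Norm (A *ᵥ (dφ - db)) := l1Norm_mulVec_le _ _
      _ ≤ kappaMax Tb * ε := by
          gcongr
          exact Finset.sum_nonneg fun _ _ => abs_nonneg _
      _ = ε * kappaMax Tb := mul_comm _ _
  have hnn : 0 ≤ ε * kappaMax Tb := mul_nonneg hε0 hκ0.le
  exact hbound.trans (le_div_self hnn (sub_pos.2 hlt) (sub_le_self _ hnn))
end

section
/- Let T ∈ ℝ^{N×N} be a positive row-stochastic matrix. If v ∈ ℝ^N satisfies Σ_{i=1}^N v_i = 0 and (I − Tᵀ)v = 0, then v = 0. Equivalently, the (N+1)×N matrix whose first row is the all-ones row vector and whose remaining N rows form I − Tᵀ has trivial kernel (its associated linear map ℝ^N → ℝ^{N+1} is injective, so the matrix has rank N). -/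
open Matrix BigOperators

/-- A real vector fixed by the transpose of a nonnegative row-stochastic matrix has its absolute
value fixed as well. -/
theorem sum_mul_abs_eq_abs_of_fixed {ι : Type*} [Fintype ι] {T : Matrix ι ι ℝ}
    (hT : ∀ i j, 0 ≤ T i j) (hrow : ∀ i, ∑ j, T i j = 1) {v : ι → ℝ}
    (hv : ∀ j, ∑ i, T i j * v i = v j) (j : ι) : ∑ i, T i j * |v i| = |v j| := by
  have hle : ∀ j ∈ Finset.univ, |v j| ≤ ∑ i, T i j * |v i| := fun j _ => by
    rw [← hv j]
    refine (Finset.abs_sum_le_sum_abs _ _).trans_eq (Finset.sum_congr rfl fun i _ => ?_)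
    rw [abs_mul, abs_of_nonneg (hT i j)]
  have htotal : ∑ j, |v j| = ∑ j, ∑ i, T i j * |v i| := by
    rw [Finset.sum_comm]
    simp [← Finset.sum_mul, hrow]
  exact ((Finset.sum_eq_sum_iff_of_le hle).1 htotal j (Finset.mem_univ j)).symm

/-- If `v` is fixed by the transpose of a positive row-stochastic matrix and has a nonnegative
entry, then all its entries are nonnegative. -/
theorem nonneg_of_fixed_of_nonneg {ι : Type*} [Fintype ι] {T : Matrix ι ι ℝ}
    (hT : ∀ i j, 0 < T i j) (hrow : ∀ i, ∑ j, T i j = 1) {v : ι → ℝ}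
    (hv : ∀ j, ∑ i, T i j * v i = v j) {j : ι} (hj : 0 ≤ v j) (i : ι) : 0 ≤ v i := by
  have habs := sum_mul_abs_eq_abs_of_fixed (fun i j => (hT i j).le) hrow hv j
  rw [abs_of_nonneg hj, ← hv j, eq_comm, Finset.sum_eq_sum_iff_of_le
    fun i _ => mul_le_mul_of_nonneg_left (le_abs_self (v i)) (hT i j).le] at habs
  rw [mul_left_cancel₀ (hT i j).ne' (habs i (Finset.mem_univ i))]
  exact abs_nonneg _

/-- The only vector of entry sum zero fixed by the transpose of a positive row-stochastic matrix
is zero. -/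
theorem eq_zero_of_fixed_of_sum_eq_zero {ι : Type*} [Fintype ι] {T : Matrix ι ι ℝ}
    (hT : ∀ i j, 0 < T i j) (hrow : ∀ i, ∑ j, T i j = 1) {v : ι → ℝ}
    (hv : ∀ j, ∑ i, T i j * v i = v j) (hsum : ∑ i, v i = 0) : v = 0 := by
  funext j
  rcases le_total 0 (v j) with hj | hj
  · exact (Finset.sum_eq_zero_iff_of_nonneg fun i _ =>
      nonneg_of_fixed_of_nonneg hT hrow hv hj i).1 hsum j (Finset.mem_univ j)
  · have hneg : ∀ i, 0 ≤ (-v) i := nonneg_of_fixed_of_nonneg hT hrow (v := -v) (j := j)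
      (fun k => by simp [hv k]) (by simpa using hj)
    exact (Finset.sum_eq_zero_iff_of_nonpos fun i _ => by simpa using hneg i).1 hsum j
      (Finset.mem_univ j)

/-- For a positive row-stochastic matrix `T`: if `v` has entries summing to `0` and
`(I − Tᵀ)v = 0`, then `v = 0`; equivalently, the `(N+1)×N` matrix whose first row is
all ones and whose remaining rows form `I − Tᵀ` has trivial kernel (its associated
linear map is injective, so it has rank `N`). -/
theorem hatMat_injective {N : ℕ} (T : Matrix (Fin N) (Fin N) ℝ)
    (hpos : ∀ i j, 0 < T i j) (hrow : ∀ i, ∑ j, T i j = 1) :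
    (∀ v : Fin N → ℝ, (∑ i, v i) = 0 →
        ((1 : Matrix (Fin N) (Fin N) ℝ) - Tᵀ) *ᵥ v = 0 → v = 0)
    ∧ Function.Injective (hatMat T).mulVec := by
  have key : ∀ v : Fin N → ℝ, (∑ i, v i) = 0 →
      ((1 : Matrix (Fin N) (Fin N) ℝ) - Tᵀ) *ᵥ v = 0 → v = 0 := by
    intro v hsum hv
    refine eq_zero_of_fixed_of_sum_eq_zero hpos hrow (fun j => ?_) hsum
    rw [sub_mulVec, one_mulVec, sub_eq_zero] at hv
    exact (congrFun hv j).symm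
  refine ⟨key, (injective_iff_map_eq_zero (hatMat T).mulVecLin).2 fun v hv => key v ?_ ?_⟩
  · simpa [hatMat, mulVec, dotProduct] using congrFun hv 0
  · funext i
    simpa [hatMat, mulVec, dotProduct] using congrFun hv i.succ
end

section
/- Let T ∈ ℝ^{N×N} be a positive row-stochastic matrix and let M̂ ∈ ℝ^{(N+1)×N} be the matrix whose first row is the all-ones row vector and whose remaining N rows form I − Tᵀ. Then there exists an index i ∈ {2,…,N+1} such that the N×N matrix obtained from M̂ by deleting row i is invertible. In particular, the stationary distribution d of T is the unique solution of the resulting nonsingular linear system whose right-hand side is the first standard basis vector when i = N+1 is such an index. -/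
open Matrix BigOperators

section StationaryVectors

variable {N : ℕ}

lemma hatMat_mulVec_zero (T : Matrix (Fin N) (Fin N) ℝ) (v : Fin N → ℝ) :
    (hatMat T *ᵥ v) 0 = ∑ j, v j := by
  simp [hatMat, Matrix.mulVec, dotProduct]

lemma hatMat_mulVec_succ (T : Matrix (Fin N) (Fin N) ℝ) (v : Fin N → ℝ) (k : Fin N) :
    (hatMat T *ᵥ v) k.succ = v k - (v ᵥ* T) k := by
  have h : (hatMat T *ᵥ v) k.succ = ((1 - Tᵀ) *ᵥ v) k := by
    simp [hatMat, Matrix.mulVec, dotProduct]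
  rw [h, Matrix.sub_mulVec, Matrix.one_mulVec, Matrix.mulVec_transpose, Pi.sub_apply]

lemma delRow_mulVec (M : Matrix (Fin (N + 1)) (Fin N) ℝ) (i : Fin (N + 1)) (v : Fin N → ℝ)
    (k : Fin N) : (delRow M i *ᵥ v) k = (M *ᵥ v) (i.succAbove k) := rfl

/-- Right multiplication by a row-stochastic matrix preserves the sum of the entries. -/
lemma sum_vecMul_of_row_sum_eq_one {ι : Type*} [Fintype ι] (T : Matrix ι ι ℝ)
    (hrow : ∀ i, ∑ j, T i j = 1) (v : ι → ℝ) : ∑ j, (v ᵥ* T) j = ∑ j, v j := by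
  simp only [Matrix.vecMul, dotProduct]
  rw [Finset.sum_comm]
  simp [← Finset.mul_sum, hrow]

/-- A nonnegative fixed row vector of a positive matrix vanishes once one entry does. -/
lemma eq_zero_of_vecMul_eq_self_of_apply_eq_zero {ι : Type*} [Fintype ι] {T : Matrix ι ι ℝ}
    (hpos : ∀ i j, 0 < T i j) {w : ι → ℝ} (hw : ∀ i, 0 ≤ w i) (hfix : w ᵥ* T = w)
    {k : ι} (hk : w k = 0) : w = 0 := by
  have h : ∑ i, w i * T i k = 0 := (congrFun hfix k).trans hk
  rw [Finset.sum_eq_zero_iff_of_nonneg fun i _ => mul_nonneg (hw i) (hpos i k).le] at h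
  funext i
  exact (mul_eq_zero.mp (h i (Finset.mem_univ i))).resolve_right (hpos i k).ne'

/-- A fixed row vector of a positive matrix with a stationary distribution is zero if its
entries sum to zero. -/
lemma eq_zero_of_vecMul_eq_self_of_sum_eq_zero_s7 {ι : Type*} [Fintype ι] [Nonempty ι]
    {T : Matrix ι ι ℝ} (hpos : ∀ i j, 0 < T i j) {d : ι → ℝ} (hd_nonneg : ∀ i, 0 ≤ d i)
    (hd_sum : ∑ i, d i = 1) (hd_stat : d ᵥ* T = d) {v : ι → ℝ} (hv : v ᵥ* T = v)
    (hv_sum : ∑ i, v i = 0) : v = 0 := by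
  have hd_pos : ∀ i, 0 < d i := fun i => by
    refine (hd_nonneg i).lt_of_ne fun h => ?_
    have h0 := eq_zero_of_vecMul_eq_self_of_apply_eq_zero hpos hd_nonneg hd_stat h.symm
    simp [h0] at hd_sum
  obtain ⟨k, hk⟩ := Finite.exists_min fun i => v i / d i
  set c := v k / d k with hc
  have hw : v - c • d = 0 := by
    refine eq_zero_of_vecMul_eq_self_of_apply_eq_zero hpos (k := k) (fun i => ?_) ?_ ?_
    · have := (le_div_iff₀ (hd_pos i)).mp (hk i)
      simpa using this
    · rw [Matrix.sub_vecMul, Matrix.smul_vecMul, hv, hd_stat]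
    · simp [hc, div_mul_cancel₀ _ (hd_pos k).ne']
  have hvc : v = c • d := sub_eq_zero.mp hw
  have hc0 : c = 0 := by
    have h := hv_sum
    rw [hvc] at h
    simpa [← Finset.mul_sum, hd_sum] using h
  rw [hvc, hc0, zero_smul]

end StationaryVectors

/-- For a positive row-stochastic matrix `T` (of size `N+1 ≥ 1`) with stationary
distribution `d` and `M̂` the matrix with an all-ones first row above `I − Tᵀ`:
some row `i ∈ {2,…,N+2}` of `M̂` can be deleted so that the remaining square matrix is
invertible; and whenever deleting the last row yields an invertible matrix `A`, the
stationary distribution `d` satisfies `A d = e₁` and is the unique solution of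
`A v = e₁`, where `e₁` is the first standard basis vector. -/
theorem exists_invertible_delRow {N : ℕ} (T : Matrix (Fin (N + 1)) (Fin (N + 1)) ℝ)
    (hpos : ∀ i j, 0 < T i j) (hrow : ∀ i, ∑ j, T i j = 1)
    (d : Fin (N + 1) → ℝ) (hd_nonneg : ∀ i, 0 ≤ d i) (hd_sum : ∑ i, d i = 1)
    (hd_stat : Matrix.vecMul d T = d) :
    (∃ i : Fin (N + 2), i ≠ 0 ∧ IsUnit (delRow (hatMat T) i).det)
    ∧ (IsUnit (delRow (hatMat T) (Fin.last (N + 1))).det →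
        (delRow (hatMat T) (Fin.last (N + 1))) *ᵥ d = Pi.single (0 : Fin (N + 1)) (1 : ℝ)
        ∧ ∀ v : Fin (N + 1) → ℝ,
            (delRow (hatMat T) (Fin.last (N + 1))) *ᵥ v = Pi.single (0 : Fin (N + 1)) (1 : ℝ)
            → v = d) := by
  constructor
  · refine ⟨Fin.last (N + 1), Fin.last_pos.ne', isUnit_iff_ne_zero.mpr fun hdet => ?_⟩
    obtain ⟨v, hv_ne, hv⟩ := Matrix.exists_mulVec_eq_zero_iff.mpr hdet
    have hrows : ∀ k : Fin (N + 1), (hatMat T *ᵥ v) k.castSucc = 0 := fun k => by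
      simpa [delRow_mulVec] using congrFun hv k
    have hv_sum : ∑ j, v j = 0 := by
      rw [← hatMat_mulVec_zero T v]
      exact hrows 0
    have hfix : ∀ k : Fin N, (v ᵥ* T) k.castSucc = v k.castSucc := fun k => by
      have h := hrows k.succ
      rw [← Fin.succ_castSucc, hatMat_mulVec_succ] at h
      exact (sub_eq_zero.mp h).symm
    have hlast : (v ᵥ* T) (Fin.last N) = v (Fin.last N) := by
      have h := sum_vecMul_of_row_sum_eq_one T hrow v
      simpa [Fin.sum_univ_castSucc, hfix] using h
    exact hv_ne (eq_zero_of_vecMul_eq_self_of_sum_eq_zero_s7 hpos hd_nonneg hd_sum hd_stat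
      (funext fun k => Fin.lastCases hlast hfix k) hv_sum)
  · intro hunit
    have hd : delRow (hatMat T) (Fin.last (N + 1)) *ᵥ d = Pi.single 0 1 := by
      funext k
      rw [delRow_mulVec, Fin.succAbove_last]
      refine Fin.cases ?_ (fun k => ?_) k
      · rw [Fin.castSucc_zero, hatMat_mulVec_zero, hd_sum, Pi.single_eq_same]
      · rw [← Fin.succ_castSucc, hatMat_mulVec_succ, hd_stat, sub_self,
          Pi.single_eq_of_ne (Fin.succ_ne_zero k)]
    exact ⟨hd, fun v hv => Matrix.mulVec_injective_of_isUnit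
      ((Matrix.isUnit_iff_isUnit_det _).mpr hunit) (hv.trans hd.symm)⟩
end

section
/- Consider a finite Markov decision process: finite nonempty state set S and action set A, transition probabilities P : S × A × S → ℝ with P(s'|s,a) ≥ 0 and Σ_{s'} P(s'|s,a) = 1, a policy π : S × A → ℝ with π(a|s) ≥ 0 and Σ_a π(a|s) = 1, an initial state distribution μ₀ on S, and a discount factor γ ∈ [0,1). Let g : S × A → ℝ and let f : S × A → ℝ be the (unique) solution of the Bellman equation f(s,a) = g(s,a) + γ Σ_{s'} P(s'|s,a) Σ_{a'} π(a'|s') f(s',a') for all (s,a). Define the discounted visitation frequency d^π(s,a) = (1−γ) Σ_{t=0}^∞ γ^t ρ_t(s,a), where ρ_0(s,a) = μ₀(s)π(a|s) and ρ_{t+1}(s',a') = Σ_{s,a} ρ_t(s,a) P(s'|s,a) π(a'|s'). Then Σ_s μ₀(s) Σ_a π(a|s) f(s,a) = (1−γ)^{-1} Σ_{s,a} d^π(s,a) g(s,a). -/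
open BigOperators

/-- The expectation of `f` one step later equals the expectation of the conditional expectation
of `f` after one step. -/
theorem sum_occupancy_succ {S A : Type*} [Fintype S] [Fintype A]
    {P : S → A → S → ℝ} {π : S → A → ℝ} {ρ : ℕ → S → A → ℝ}
    (hρsucc : ∀ t s' a', ρ (t + 1) s' a' = (∑ s, ∑ a, ρ t s a * P s a s') * π s' a')
    (f : S → A → ℝ) (t : ℕ) :
    ∑ s, ∑ a, ρ (t + 1) s a * f s a =
      ∑ s, ∑ a, ρ t s a * ∑ s', P s a s' * ∑ a', π s' a' * f s' a' := by
  simp only [hρsucc, mul_assoc, ← Finset.mul_sum]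
  simp only [Finset.sum_mul]
  rw [Finset.sum_comm]
  refine Finset.sum_congr rfl fun s _ => ?_
  rw [Finset.sum_comm]
  refine Finset.sum_congr rfl fun a _ => ?_
  simp only [Finset.mul_sum, mul_assoc]

/-- The occupancy distributions of a finite Markov decision process are probability
distributions. -/
theorem occupancy_nonneg_and_sum_eq_one {S A : Type*} [Fintype S] [Fintype A]
    {P : S → A → S → ℝ} (hP_nonneg : ∀ s a s', 0 ≤ P s a s')
    (hP_sum : ∀ s a, ∑ s', P s a s' = 1)
    {π : S → A → ℝ} (hπ_nonneg : ∀ s a, 0 ≤ π s a) (hπ_sum : ∀ s, ∑ a, π s a = 1)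
    {μ0 : S → ℝ} (hμ0_nonneg : ∀ s, 0 ≤ μ0 s) (hμ0_sum : ∑ s, μ0 s = 1)
    {ρ : ℕ → S → A → ℝ} (hρ0 : ∀ s a, ρ 0 s a = μ0 s * π s a)
    (hρsucc : ∀ t s' a', ρ (t + 1) s' a' = (∑ s, ∑ a, ρ t s a * P s a s') * π s' a') (t : ℕ) :
    (∀ s a, 0 ≤ ρ t s a) ∧ ∑ s, ∑ a, ρ t s a = 1 := by
  induction t with
  | zero =>
    refine ⟨fun s a => hρ0 s a ▸ mul_nonneg (hμ0_nonneg s) (hπ_nonneg s a), ?_⟩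
    simp [hρ0, ← Finset.mul_sum, hπ_sum, hμ0_sum]
  | succ t ih =>
    refine ⟨fun s a => ?_, ?_⟩
    · rw [hρsucc]
      exact mul_nonneg (Finset.sum_nonneg fun x _ => Finset.sum_nonneg fun y _ =>
        mul_nonneg (ih.1 x y) (hP_nonneg x y s)) (hπ_nonneg s a)
    · have h := sum_occupancy_succ hρsucc (fun _ _ => 1) t
      simpa only [mul_one, hπ_sum, hP_sum, ih.2] using h

/-- In a finite MDP with discount `γ ∈ [0,1)`, if `f` solves the Bellman equation
`f(s,a) = g(s,a) + γ Σ_{s'} P(s'|s,a) Σ_{a'} π(a'|s') f(s',a')` and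
`d^π(s,a) = (1−γ) Σ_t γ^t ρ_t(s,a)` is the discounted visitation frequency, then
`Σ_s μ₀(s) Σ_a π(a|s) f(s,a) = (1−γ)⁻¹ Σ_{s,a} d^π(s,a) g(s,a)`. -/
theorem discounted_visitation_value_identity
    {S A : Type*} [Fintype S] [Fintype A] [Nonempty S] [Nonempty A]
    (P : S → A → S → ℝ) (hP_nonneg : ∀ s a s', 0 ≤ P s a s')
    (hP_sum : ∀ s a, ∑ s', P s a s' = 1)
    (π : S → A → ℝ) (hπ_nonneg : ∀ s a, 0 ≤ π s a) (hπ_sum : ∀ s, ∑ a, π s a = 1)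
    (μ0 : S → ℝ) (hμ0_nonneg : ∀ s, 0 ≤ μ0 s) (hμ0_sum : ∑ s, μ0 s = 1)
    (γ : ℝ) (hγ0 : 0 ≤ γ) (hγ1 : γ < 1)
    (g f : S → A → ℝ)
    (hf : ∀ s a, f s a = g s a + γ * ∑ s', P s a s' * ∑ a', π s' a' * f s' a')
    (ρ : ℕ → S → A → ℝ)
    (hρ0 : ∀ s a, ρ 0 s a = μ0 s * π s a)
    (hρsucc : ∀ t s' a', ρ (t + 1) s' a' = (∑ s, ∑ a, ρ t s a * P s a s') * π s' a')
    (dπ : S → A → ℝ)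
    (hdπ : ∀ s a, dπ s a = (1 - γ) * ∑' t : ℕ, γ ^ t * ρ t s a) :
    ∑ s, μ0 s * ∑ a, π s a * f s a = (1 - γ)⁻¹ * ∑ s, ∑ a, dπ s a * g s a := by
  have hρ := occupancy_nonneg_and_sum_eq_one hP_nonneg hP_sum hπ_nonneg hπ_sum
    hμ0_nonneg hμ0_sum hρ0 hρsucc
  have hρ_le : ∀ t s a, ρ t s a ≤ 1 := fun t s a =>
    calc ρ t s a ≤ ∑ a, ρ t s a :=
          Finset.single_le_sum (fun b _ => (hρ t).1 s b) (Finset.mem_univ a)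
      _ ≤ ∑ s, ∑ a, ρ t s a :=
          Finset.single_le_sum (f := fun s => ∑ a, ρ t s a)
            (fun x _ => Finset.sum_nonneg fun b _ => (hρ t).1 x b) (Finset.mem_univ s)
      _ = 1 := (hρ t).2
  have hsummable : ∀ s a, Summable fun t : ℕ => γ ^ t * ρ t s a := fun s a =>
    Summable.of_nonneg_of_le (fun t => mul_nonneg (pow_nonneg hγ0 t) ((hρ t).1 s a))
      (fun t => mul_le_of_le_one_right (pow_nonneg hγ0 t) (hρ_le t s a))
      (summable_geometric_of_lt_one hγ0 hγ1)
  have hasSum_pairing : ∀ h : S → A → ℝ, HasSum (fun t : ℕ => γ ^ t * ∑ s, ∑ a, ρ t s a * h s a)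
      (∑ s, ∑ a, (∑' t : ℕ, γ ^ t * ρ t s a) * h s a) := fun h => by
    simp only [Finset.mul_sum, ← mul_assoc]
    exact hasSum_sum fun s _ => hasSum_sum fun a _ => (hsummable s a).hasSum.mul_right (h s a)
  have hstep : ∀ t, γ ^ t * ∑ s, ∑ a, ρ t s a * f s a =
      γ ^ t * (∑ s, ∑ a, ρ t s a * g s a) + γ ^ (t + 1) * ∑ s, ∑ a, ρ (t + 1) s a * f s a := by
    intro t
    have hbellman : ∑ s, ∑ a, ρ t s a * f s a =
        ∑ s, ∑ a, ρ t s a * g s a + γ * ∑ s, ∑ a, ρ (t + 1) s a * f s a := by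
      rw [sum_occupancy_succ hρsucc]
      simp only [Finset.mul_sum (a := γ), ← Finset.sum_add_distrib]
      refine Finset.sum_congr rfl fun s _ => Finset.sum_congr rfl fun a _ => ?_
      rw [hf s a]
      ring
    rw [hbellman]
    ring
  have hvalue : ∑ s, ∑ a, ρ 0 s a * f s a =
      ∑ s, ∑ a, (∑' t : ℕ, γ ^ t * ρ t s a) * g s a := by
    have htail := (hasSum_nat_add_iff' 1).mpr (hasSum_pairing f)
    have hsum := (hasSum_pairing g).add htail
    simp only [← hstep] at hsum
    have := hsum.unique (hasSum_pairing f)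
    simp only [Finset.sum_range_one, pow_zero, one_mul] at this
    linarith
  have hγ : 1 - γ ≠ 0 := by linarith
  simp only [hdπ, mul_assoc, ← Finset.mul_sum, inv_mul_cancel_left₀ hγ]
  rw [← hvalue]
  simp only [hρ0, mul_assoc, Finset.mul_sum]
end
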